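/- Let n ≥ 2, f(x,y,z) = x² + y² + z² + 2(xz − xy + yz), and F_n(x,y,z) = f(x^n,y^n,z^n). The singular locus of the curve C̃_n = {F_n = 0} ⊂ ℙ²(ℂ), i.e. the set of points [x:y:z] ∈ ℙ²(ℂ) at which F_n and all three partial derivatives ∂F_n/∂x, ∂F_n/∂y, ∂F_n/∂z vanish, is exactly the set {[1:ζ:0] : ζ ∈ ℂ, ζ^n = 1} ∪ {[0:1:ζ] : ζ ∈ ℂ, ζ^n = −1} ∪ {[1:0:ζ] : ζ ∈ ℂ, ζ^n = −1}. In particular, C̃_n has exactly 3n singular points. -/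

import Mathlib

open MvPolynomial

noncomputable section

/-- The conic `f(x,y,z) = x² + y² + z² + 2(xz − xy + yz)`. -/
def fPoly : MvPolynomial (Fin 3) ℂ :=
  X 0 ^ 2 + X 1 ^ 2 + X 2 ^ 2 + 2 * (X 0 * X 2 - X 0 * X 1 + X 1 * X 2)

/-- `F_n(x,y,z) = f(xⁿ, yⁿ, zⁿ)`. -/
def Fn (n : ℕ) : MvPolynomial (Fin 3) ℂ :=
  bind₁ (fun i => X i ^ n) fPoly

instance : TopologicalSpace (Projectivization ℂ (Fin 3 → ℂ)) :=
  inferInstanceAs (TopologicalSpace (Quotient (projectivizationSetoid ℂ (Fin 3 → ℂ))))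

/-- The singular locus of the curve `C̃_n = {F_n = 0} ⊆ ℙ²(ℂ)`: the points at which `F_n` and
its three partial derivatives vanish. -/
def singLocus (n : ℕ) : Set (Projectivization ℂ (Fin 3 → ℂ)) :=
  {p | eval p.rep (Fn n) = 0 ∧ ∀ i : Fin 3, eval p.rep (pderiv i (Fn n)) = 0}

/-- The set `{[1:ζ:0] : ζⁿ = 1} ∪ {[0:1:ζ] : ζⁿ = −1} ∪ {[1:0:ζ] : ζⁿ = −1}`. -/
def expectedSingPoints (n : ℕ) : Set (Projectivization ℂ (Fin 3 → ℂ)) :=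
  {p | ∃ ζ : ℂ,
    (ζ ^ n = 1 ∧ ∃ h, p = Projectivization.mk ℂ ![1, ζ, 0] h) ∨
    (ζ ^ n = -1 ∧ ∃ h, p = Projectivization.mk ℂ ![0, 1, ζ] h) ∨
    (ζ ^ n = -1 ∧ ∃ h, p = Projectivization.mk ℂ ![1, 0, ζ] h)}

theorem Fn_eq (n : ℕ) : Fn n = (X 0 ^ n) ^ 2 + (X 1 ^ n) ^ 2 + (X 2 ^ n) ^ 2 +
      2 * (X 0 ^ n * X 2 ^ n - X 0 ^ n * X 1 ^ n + X 1 ^ n * X 2 ^ n) := by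
  simp [Fn, fPoly, map_ofNat]

theorem eval_Fn (n : ℕ) (v : Fin 3 → ℂ) : eval v (Fn n) =
    (v 0 ^ n) ^ 2 + (v 1 ^ n) ^ 2 + (v 2 ^ n) ^ 2 +
      2 * (v 0 ^ n * v 2 ^ n - v 0 ^ n * v 1 ^ n + v 1 ^ n * v 2 ^ n) := by
  simp [Fn_eq]

theorem pderiv_two (i : Fin 3) : pderiv i (2 : MvPolynomial (Fin 3) ℂ) = 0 := by
  have h : (2 : MvPolynomial (Fin 3) ℂ) = C 2 := (map_ofNat C 2).symm
  rw [h, pderiv_C]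

theorem d0 (n : ℕ) (v : Fin 3 → ℂ) : eval v (pderiv 0 (Fn n)) =
    2 * n * v 0 ^ (n - 1) * (v 0 ^ n - v 1 ^ n + v 2 ^ n) := by
  simp [Fn_eq, pderiv_X, pderiv_two]
  ring

theorem d1 (n : ℕ) (v : Fin 3 → ℂ) : eval v (pderiv 1 (Fn n)) =
    2 * n * v 1 ^ (n - 1) * (v 1 ^ n - v 0 ^ n + v 2 ^ n) := by
  simp [Fn_eq, pderiv_X, pderiv_two]
  ring

theorem d2 (n : ℕ) (v : Fin 3 → ℂ) : eval v (pderiv 2 (Fn n)) =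
    2 * n * v 2 ^ (n - 1) * (v 2 ^ n + v 0 ^ n + v 1 ^ n) := by
  simp [Fn_eq, pderiv_X, pderiv_two]
  ring

theorem ne1 (ζ : ℂ) : (![1, ζ, 0] : Fin 3 → ℂ) ≠ 0 := fun h => by simpa using congrFun h 0
theorem ne2 (ζ : ℂ) : (![0, 1, ζ] : Fin 3 → ℂ) ≠ 0 := fun h => by simpa using congrFun h 1
theorem ne3 (ζ : ℂ) : (![1, 0, ζ] : Fin 3 → ℂ) ≠ 0 := fun h => by simpa using congrFun h 0

def g1 (ζ : ℂ) : Projectivization ℂ (Fin 3 → ℂ) := Projectivization.mk ℂ ![1, ζ, 0] (ne1 ζ)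
def g2 (ζ : ℂ) : Projectivization ℂ (Fin 3 → ℂ) := Projectivization.mk ℂ ![0, 1, ζ] (ne2 ζ)
def g3 (ζ : ℂ) : Projectivization ℂ (Fin 3 → ℂ) := Projectivization.mk ℂ ![1, 0, ζ] (ne3 ζ)

theorem g1_inj : Function.Injective g1 := by
  intro a b h
  obtain ⟨c, hc⟩ := (Projectivization.mk_eq_mk_iff' ℂ _ _ _ _).1 h
  have h0 := congrFun hc 0
  have h1 := congrFun hc 1
  simp at h0 h1
  simp_all

theorem g2_inj : Function.Injective g2 := by
  intro a b h
  obtain ⟨c, hc⟩ := (Projectivization.mk_eq_mk_iff' ℂ _ _ _ _).1 h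
  have h0 := congrFun hc 1
  have h1 := congrFun hc 2
  simp at h0 h1
  simp_all

theorem g3_inj : Function.Injective g3 := by
  intro a b h
  obtain ⟨c, hc⟩ := (Projectivization.mk_eq_mk_iff' ℂ _ _ _ _).1 h
  have h0 := congrFun hc 0
  have h1 := congrFun hc 2
  simp at h0 h1
  simp_all

theorem g12 (a b : ℂ) : g1 a ≠ g2 b := by
  intro h
  obtain ⟨c, hc⟩ := (Projectivization.mk_eq_mk_iff' ℂ _ _ _ _).1 h
  simpa using congrFun hc 0

theorem g23 (a b : ℂ) : g2 a ≠ g3 b := by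
  intro h
  obtain ⟨c, hc⟩ := (Projectivization.mk_eq_mk_iff' ℂ _ _ _ _).1 h
  simpa using congrFun hc 1

theorem g13 (a b : ℂ) (ha : a ≠ 0) : g1 a ≠ g3 b := by
  intro h
  obtain ⟨c, hc⟩ := (Projectivization.mk_eq_mk_iff' ℂ _ _ _ _).1 h
  have h1 := congrFun hc 1
  simp at h1
  exact ha h1.symm

theorem expected_eq (n : ℕ) : expectedSingPoints n =
    g1 '' {ζ | ζ ^ n = 1} ∪ (g2 '' {ζ | ζ ^ n = -1} ∪ g3 '' {ζ | ζ ^ n = -1}) := by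
  ext p
  constructor
  · rintro ⟨ζ, ⟨h, _, rfl⟩ | ⟨h, _, rfl⟩ | ⟨h, _, rfl⟩⟩
    · exact Or.inl ⟨ζ, h, rfl⟩
    · exact Or.inr (Or.inl ⟨ζ, h, rfl⟩)
    · exact Or.inr (Or.inr ⟨ζ, h, rfl⟩)
  · rintro (⟨ζ, h, rfl⟩ | ⟨ζ, h, rfl⟩ | ⟨ζ, h, rfl⟩)
    · exact ⟨ζ, Or.inl ⟨h, ne1 ζ, rfl⟩⟩
    · exact ⟨ζ, Or.inr (Or.inl ⟨h, ne2 ζ, rfl⟩)⟩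
    · exact ⟨ζ, Or.inr (Or.inr ⟨h, ne3 ζ, rfl⟩)⟩

theorem roots_finset (n : ℕ) (hn : 2 ≤ n) (a : ℂ) :
    {ζ : ℂ | ζ ^ n = a} = ((Polynomial.nthRoots n a).toFinset : Set ℂ) := by
  ext ζ
  simp [Polynomial.mem_nthRoots (show 0 < n by omega)]

theorem roots_fin (n : ℕ) (hn : 2 ≤ n) (a : ℂ) : {ζ : ℂ | ζ ^ n = a}.Finite := by
  rw [roots_finset n hn]
  exact Finset.finite_toSet _

theorem roots_card (n : ℕ) (hn : 2 ≤ n) (a : ℂ) (ha : a ≠ 0) :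
    {ζ : ℂ | ζ ^ n = a}.ncard = n := by
  have hp := Complex.isPrimitiveRoot_exp n (by omega)
  obtain ⟨w, hw⟩ := IsAlgClosed.exists_pow_nat_eq a (show 0 < n by omega)
  rw [roots_finset n hn, Set.ncard_coe_finset,
    Multiset.toFinset_card_of_nodup (hp.nthRoots_nodup ha), hp.card_nthRoots, if_pos ⟨w, hw⟩]

theorem expected_card (n : ℕ) (hn : 2 ≤ n) : (expectedSingPoints n).ncard = 3 * n := by
  have f1 := (roots_fin n hn 1).image g1
  have f2 := (roots_fin n hn (-1)).image g2
  have f3 := (roots_fin n hn (-1)).image g3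
  rw [expected_eq, Set.ncard_union_eq ?_ f1 (f2.union f3), Set.ncard_union_eq ?_ f2 f3,
    Set.ncard_image_of_injective _ g1_inj, Set.ncard_image_of_injective _ g2_inj,
    Set.ncard_image_of_injective _ g3_inj, roots_card n hn _ one_ne_zero,
    roots_card n hn _ (neg_ne_zero.2 one_ne_zero)]
  · ring
  · rw [Set.disjoint_left]
    rintro _ ⟨a, -, rfl⟩ ⟨b, -, h⟩
    exact g23 a b h.symm
  · rw [Set.disjoint_left]
    rintro _ ⟨a, ha, rfl⟩ (⟨b, -, h⟩ | ⟨b, -, h⟩)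
    · exact g12 a b h.symm
    · refine g13 a b ?_ h.symm
      rintro rfl
      simp [show n ≠ 0 by omega] at ha

theorem sing_eq (n : ℕ) (hn : 2 ≤ n) : singLocus n = expectedSingPoints n := by
  have hn0 : n ≠ 0 := by omega
  have hn1 : n - 1 ≠ 0 := by omega
  have hnC : (n : ℂ) ≠ 0 := by exact_mod_cast hn0
  ext p
  constructor
  · rintro ⟨-, h⟩
    have h0 := h 0
    have h1 := h 1
    have h2 := h 2
    rw [d0] at h0
    rw [d1] at h1
    rw [d2] at h2
    have hv := p.rep_nonzero
    have hp : ∃ hv : p.rep ≠ 0, Projectivization.mk ℂ p.rep hv = p := ⟨hv, p.mk_rep⟩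
    generalize p.rep = v at h0 h1 h2 hv hp
    obtain ⟨hv', hp⟩ := hp
    subst hp
    simp only [mul_eq_zero, pow_eq_zero_iff hn1, hnC, OfNat.ofNat_ne_zero, false_or] at h0 h1 h2
    by_cases x0 : v 0 = 0
    · by_cases y0 : v 1 = 0
      · exfalso
        apply hv
        have z0 : v 2 = 0 := by simpa [x0, y0, hn0] using h2
        ext i
        fin_cases i <;> simp [x0, y0, z0]
      · have e : v 1 ^ n + v 2 ^ n = 0 := by simpa [x0, y0, hn0] using h1
        refine ⟨v 2 / v 1, Or.inr (Or.inl ⟨?_, ne2 _, ?_⟩)⟩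
        · rw [div_pow, div_eq_iff (pow_ne_zero n y0)]
          linear_combination e
        · rw [Projectivization.mk_eq_mk_iff']
          refine ⟨v 1, ?_⟩
          ext i
          fin_cases i <;> simp [x0, mul_div_cancel₀, y0]
    · have hx : v 0 ^ n ≠ 0 := pow_ne_zero n x0
      have e0 := h0.resolve_left x0
      by_cases y0 : v 1 = 0
      · refine ⟨v 2 / v 0, Or.inr (Or.inr ⟨?_, ne3 _, ?_⟩)⟩
        · rw [div_pow, div_eq_iff hx]
          simp only [y0, zero_pow hn0] at e0
          linear_combination e0
        · rw [Projectivization.mk_eq_mk_iff']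
          refine ⟨v 0, ?_⟩
          ext i
          fin_cases i <;> simp [x0, mul_div_cancel₀, y0]
      · have e1 := h1.resolve_left y0
        have z0 : v 2 = 0 := by
          have : v 2 ^ n = 0 := by linear_combination (e0 + e1) / 2
          exact (pow_eq_zero_iff hn0).1 this
        refine ⟨v 1 / v 0, Or.inl ⟨?_, ne1 _, ?_⟩⟩
        · rw [div_pow, div_eq_iff hx]
          simp only [z0, zero_pow hn0] at e0
          linear_combination -e0
        · rw [Projectivization.mk_eq_mk_iff']
          refine ⟨v 0, ?_⟩
          ext i
          fin_cases i <;> simp [x0, mul_div_cancel₀, z0]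
  · have key : ∀ (w : Fin 3 → ℂ) (hw : w ≠ 0), ∃ a : ℂ,
        (Projectivization.mk ℂ w hw).rep = a • w := by
      intro w hw
      obtain ⟨a, ha⟩ := Projectivization.exists_smul_eq_mk_rep ℂ w hw
      exact ⟨a, ha.symm⟩
    rintro ⟨ζ, ⟨h, h', rfl⟩ | ⟨h, h', rfl⟩ | ⟨h, h', rfl⟩⟩ <;>
    · obtain ⟨a, ha⟩ := key _ h'
      refine ⟨?_, fun i => ?_⟩
      · rw [eval_Fn, ha]
        simp [mul_pow, h, hn0]
        try ring
      · fin_cases i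
        · refine (d0 n _).trans ?_
          rw [ha]
          simp [mul_pow, h, hn0, hn1]
        · refine (d1 n _).trans ?_
          rw [ha]
          simp [mul_pow, h, hn0, hn1]
        · refine (d2 n _).trans ?_
          rw [ha]
          simp [mul_pow, h, hn0, hn1]

/-- For `n ≥ 2`, the singular locus of `C̃_n` is exactly
`{[1:ζ:0] : ζⁿ = 1} ∪ {[0:1:ζ] : ζⁿ = −1} ∪ {[1:0:ζ] : ζⁿ = −1}`;
in particular `C̃_n` has exactly `3n` singular points. -/
theorem singular_locus_Cn (n : ℕ) (hn : 2 ≤ n) :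
    singLocus n = expectedSingPoints n ∧ (singLocus n).ncard = 3 * n := by
  exact ⟨sing_eq n hn, by rw [sing_eq n hn]; exact expected_card n hn⟩

end
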